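/- Let S_DZ be the symmetric 3×3 real matrix with rows (3,0,1),(0,1,0),(1,0,3) (the Petrov type DZ normal form, with Ψ₀ = Ψ₄ = 3Ψ₂ = 3, Ψ₁ = Ψ₃ = 0). Then the stabilizer algebra stab(S_DZ) = {A ∈ so(G) : Aᵀ·S_DZ + S_DZ·A = 0} has dimension exactly 1. -/

import Mathlib

open Matrix

/-- The Gram matrix of the 3-dimensional Lorentzian inner product in a null triad. -/
noncomputable def Gmat : Matrix (Fin 3) (Fin 3) ℝ := !![0, 0, -1; 0, 1/2, 0; -1, 0, 0]

/-- The stabilizer algebra of a symmetric matrix `S` inside `so(G)`: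
matrices `A` with `Aᵀ·G + G·A = 0` and `Aᵀ·S + S·A = 0`. -/
noncomputable def stab (S : Matrix (Fin 3) (Fin 3) ℝ) :
    Submodule ℝ (Matrix (Fin 3) (Fin 3) ℝ) where
  carrier := {A | Aᵀ * Gmat + Gmat * A = 0 ∧ Aᵀ * S + S * A = 0}
  zero_mem' := by constructor <;> simp
  add_mem' := by
    rintro a b ⟨ha1, ha2⟩ ⟨hb1, hb2⟩
    constructor
    · have h : (a + b)ᵀ * Gmat + Gmat * (a + b)
          = (aᵀ * Gmat + Gmat * a) + (bᵀ * Gmat + Gmat * b) := by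
        rw [Matrix.transpose_add]; noncomm_ring
      rw [h, ha1, hb1, add_zero]
    · have h : (a + b)ᵀ * S + S * (a + b)
          = (aᵀ * S + S * a) + (bᵀ * S + S * b) := by
        rw [Matrix.transpose_add]; noncomm_ring
      rw [h, ha2, hb2, add_zero]
  smul_mem' := by
    rintro c a ⟨ha1, ha2⟩
    constructor
    · have h : (c • a)ᵀ * Gmat + Gmat * (c • a) = c • (aᵀ * Gmat + Gmat * a) := by
        rw [Matrix.transpose_smul, Matrix.smul_mul, Matrix.mul_smul, smul_add]
      rw [h, ha1, smul_zero]
    · have h : (c • a)ᵀ * S + S * (c • a) = c • (aᵀ * S + S * a) := by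
        rw [Matrix.transpose_smul, Matrix.smul_mul, Matrix.mul_smul, smul_add]
      rw [h, ha2, smul_zero]

/-- The Petrov type DZ normal form (`Ψ₀ = Ψ₄ = 3Ψ₂ = 3`, `Ψ₁ = Ψ₃ = 0`). -/
noncomputable def S_DZ : Matrix (Fin 3) (Fin 3) ℝ := !![3, 0, 1; 0, 1, 0; 1, 0, 3]

/-- The infinitesimal rotation (spin) fixing the type DZ normal form. -/
def infinitesimalSpin : Matrix (Fin 3) (Fin 3) ℝ := !![0, 1, 0; -2, 0, 2; 0, -1, 0]

theorem infinitesimalSpin_ne_zero : infinitesimalSpin ≠ 0 := fun h => by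
  simpa [infinitesimalSpin] using congrFun₂ h 0 1

theorem stab_S_DZ_eq_span : stab S_DZ = Submodule.span ℝ {infinitesimalSpin} := by
  ext A
  rw [Submodule.mem_span_singleton]
  change Aᵀ * Gmat + Gmat * A = 0 ∧ Aᵀ * S_DZ + S_DZ * A = 0 ↔ _
  constructor
  · rintro ⟨hG, hS⟩
    simp only [← Matrix.ext_iff, Fin.forall_fin_succ, Gmat, S_DZ, Matrix.add_apply,
      Matrix.mul_apply, Fin.sum_univ_three, Matrix.transpose_apply] at hG hS
    simp at hG hS
    refine ⟨A 0 1, ?_⟩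
    ext i j
    fin_cases i <;> fin_cases j <;> simp [infinitesimalSpin] <;> linarith
  · rintro ⟨c, rfl⟩
    constructor <;> ext i j <;> fin_cases i <;> fin_cases j <;>
      simp [infinitesimalSpin, Gmat, S_DZ, Matrix.mul_apply, Fin.sum_univ_three] <;> ring

/-- The stabilizer algebra of the Petrov type DZ normal form is exactly
one-dimensional (table entry `s₀ = 1` for type DZ). -/
theorem stab_typeDZ : Module.finrank ℝ (stab S_DZ) = 1 := by
  rw [stab_S_DZ_eq_span]
  exact finrank_span_singleton infinitesimalSpin_ne_zero
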